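/- Let n ≥ 2, a > 0, b > 0, and define u : ℝⁿ → ℝ by u(x) = x₁ / (1+|x|²)^a. Then for every x ∈ ℝⁿ with x ≠ 0: −div( A_b(x) ∇u(x) ) = −(1−b)(n−1) · x₁ / ( (1+|x|²)^a |x|² ) + 2a(n+2) · x₁ / (1+|x|²)^(a+1) − 4a(a+1) · x₁ |x|² / (1+|x|²)^(a+2). -/

import Mathlib

open scoped RealInnerProductSpace

noncomputable section

/-- The divergence `div F(x) = ∑ᵢ ∂ᵢ Fᵢ(x)` of a vector field on `ℝⁿ`. -/
def diverg {n : ℕ} (F : EuclideanSpace ℝ (Fin n) → EuclideanSpace ℝ (Fin n))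
    (x : EuclideanSpace ℝ (Fin n)) : ℝ :=
  ∑ i, fderiv ℝ F x (EuclideanSpace.single i 1) i

/-- The Meyers–Serrin matrix `A_b(x) = b·𝟙 + (1-b) (x⊗x)/|x|²`, acting on a vector `v`. -/
def meyersSerrin {n : ℕ} (b : ℝ) (x v : EuclideanSpace ℝ (Fin n)) :
    EuclideanSpace ℝ (Fin n) :=
  b • v + (((1 - b) * ⟪x, v⟫) / ‖x‖ ^ 2) • x

lemma diverg_aux {n : ℕ} (j : Fin n) (f h : EuclideanSpace ℝ (Fin n) → ℝ)
    (f' h' : EuclideanSpace ℝ (Fin n) →L[ℝ] ℝ) (x : EuclideanSpace ℝ (Fin n))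
    (hf : HasFDerivAt f f' x) (hh : HasFDerivAt h h' x) :
    diverg (fun z => f z • EuclideanSpace.single j (1:ℝ) + h z • z) x
      = f' (EuclideanSpace.single j 1) + n * h x + h' x := by
  have H := (hf.smul_const (EuclideanSpace.single j (1:ℝ))).add (hh.smul (hasFDerivAt_id x))
  have H2 : fderiv ℝ (fun z => f z • EuclideanSpace.single j (1:ℝ) + h z • z) x = _ := H.fderiv
  unfold diverg
  rw [H2]
  have hx : h' x = ∑ i, h' (EuclideanSpace.single i 1) * x i := by
    have hs : x = ∑ i, x i • EuclideanSpace.single i (1:ℝ) := by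
      ext k
      simp [Finset.sum_apply, Pi.single_apply]
    conv_lhs => rw [hs]
    simp [map_sum, mul_comm]
  rw [hx]
  simp [Finset.sum_add_distrib, Pi.single_apply]
  ring

lemma rpow_aux {n : ℕ} (c : ℝ) (x : EuclideanSpace ℝ (Fin n)) :
    HasFDerivAt (fun z : EuclideanSpace ℝ (Fin n) => (1 + ‖z‖ ^ 2) ^ c)
      ((c * (1 + ‖x‖ ^ 2) ^ (c - 1)) • (2 • innerSL ℝ x)) x := by
  have h1 : HasFDerivAt (fun z : EuclideanSpace ℝ (Fin n) => 1 + ‖z‖ ^ 2) (2 • innerSL ℝ x) x :=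
    (hasStrictFDerivAt_norm_sq x).hasFDerivAt.const_add 1
  exact h1.rpow_const (Or.inl (by positivity))

lemma grad_aux {n : ℕ} (j : Fin n) (a : ℝ) (u : EuclideanSpace ℝ (Fin n) → ℝ)
    (hu : ∀ x, u x = x j / (1 + ‖x‖ ^ 2) ^ a) (x : EuclideanSpace ℝ (Fin n)) :
    gradient u x = ((1 + ‖x‖ ^ 2) ^ (-a)) • EuclideanSpace.single j (1:ℝ)
      + (-2 * a * x j * (1 + ‖x‖ ^ 2) ^ (-a - 1)) • x := by
  have hu' : u = fun z => z j * (1 + ‖z‖ ^ 2) ^ (-a) := by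
    funext z
    rw [hu, Real.rpow_neg (by positivity), div_eq_mul_inv]
  apply HasGradientAt.gradient
  rw [hasGradientAt_iff_hasFDerivAt, hu']
  have hp : HasFDerivAt (fun z : EuclideanSpace ℝ (Fin n) => z j)
    (EuclideanSpace.proj j : EuclideanSpace ℝ (Fin n) →L[ℝ] ℝ) x :=
    (EuclideanSpace.proj j : EuclideanSpace ℝ (Fin n) →L[ℝ] ℝ).hasFDerivAt
  refine (hp.mul (rpow_aux (-a) x)).congr_fderiv ?_
  ext v
  simp [inner_add_left, inner_smul_left, EuclideanSpace.inner_single_left]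
  ring

/-- **Explicit computation for the Meyers–Serrin operator** (Section `ssec63` of the
paper). For `u(x) = x₁ / (1+|x|²)^a` one has, for `x ≠ 0`:
`-div(A_b(x)∇u(x)) = -(1-b)(n-1) x₁ / ((1+|x|²)^a |x|²)
  + 2a(n+2) x₁ / (1+|x|²)^(a+1) - 4a(a+1) x₁ |x|² / (1+|x|²)^(a+2)`. -/
theorem meyersSerrin_explicit_computation
    {n : ℕ} (hn : 2 ≤ n) (a b : ℝ) (ha : 0 < a) (hb : 0 < b)
    (u : EuclideanSpace ℝ (Fin n) → ℝ)
    (hu : ∀ x : EuclideanSpace ℝ (Fin n),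
      u x = x ⟨0, by omega⟩ / (1 + ‖x‖ ^ 2) ^ a) :
    ∀ x : EuclideanSpace ℝ (Fin n), x ≠ 0 →
      -diverg (fun z => meyersSerrin b z (gradient u z)) x
        = -((1 - b) * ((n : ℝ) - 1)) * x ⟨0, by omega⟩ / ((1 + ‖x‖ ^ 2) ^ a * ‖x‖ ^ 2)
          + 2 * a * ((n : ℝ) + 2) * x ⟨0, by omega⟩ / (1 + ‖x‖ ^ 2) ^ (a + 1)
          - 4 * a * (a + 1) * x ⟨0, by omega⟩ * ‖x‖ ^ 2 / (1 + ‖x‖ ^ 2) ^ (a + 2) := by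
  intro x hx
  generalize_proofs hj at hu ⊢
  set j : Fin n := ⟨0, hj⟩ with hjdef
  have hF : (fun z => meyersSerrin b z (gradient u z)) = fun z =>
      (b * (1 + ‖z‖ ^ 2) ^ (-a)) • EuclideanSpace.single j (1:ℝ)
      + (z j * ((1 - b) * ((1 + ‖z‖ ^ 2) ^ (-a) * (‖z‖ ^ 2)⁻¹)
          - 2 * a * (1 + ‖z‖ ^ 2) ^ (-a - 1))) • z := by
    funext z
    rw [grad_aux j a u hu z]
    unfold meyersSerrin
    by_cases hz : z = 0
    · simp [hz]
    have hr : ‖z‖ ≠ 0 := norm_ne_zero_iff.mpr hz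
    have hi : ⟪z, ((1 + ‖z‖ ^ 2) ^ (-a)) • EuclideanSpace.single j (1:ℝ)
      + (-2 * a * z j * (1 + ‖z‖ ^ 2) ^ (-a - 1)) • z⟫ = (1 + ‖z‖ ^ 2) ^ (-a) * z j
      + (-2 * a * z j * (1 + ‖z‖ ^ 2) ^ (-a - 1)) * ‖z‖ ^ 2 := by
      rw [inner_add_right, inner_smul_right, inner_smul_right, real_inner_self_eq_norm_sq,
        EuclideanSpace.inner_single_right]
      simp
    rw [hi, smul_add, smul_smul, smul_smul, add_assoc, ← add_smul]
    congr 2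
    field_simp
    ring
  have hr : ‖x‖ ≠ 0 := norm_ne_zero_iff.mpr hx
  have hp : HasFDerivAt (fun z : EuclideanSpace ℝ (Fin n) => z j)
    (EuclideanSpace.proj j : EuclideanSpace ℝ (Fin n) →L[ℝ] ℝ) x :=
    (EuclideanSpace.proj j : EuclideanSpace ℝ (Fin n) →L[ℝ] ℝ).hasFDerivAt
  have hn2 : HasFDerivAt (fun z : EuclideanSpace ℝ (Fin n) => ‖z‖ ^ 2) (2 • innerSL ℝ x) x :=
    (hasStrictFDerivAt_norm_sq x).hasFDerivAt
  have hinv : HasFDerivAt (fun z : EuclideanSpace ℝ (Fin n) => (‖z‖ ^ 2)⁻¹)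
      ((-((‖x‖ ^ 2) ^ 2)⁻¹) • (2 • innerSL ℝ x)) x :=
    (hasDerivAt_inv (pow_ne_zero 2 hr)).comp_hasFDerivAt x hn2
  have H1 := (rpow_aux (-a) x).const_mul b
  have H2 := hp.mul (((((rpow_aux (-a) x).mul hinv).const_mul (1 - b))).sub
    ((rpow_aux (-a - 1) x).const_mul (2 * a)))
  rw [hF]
  have key := diverg_aux j _ _ _ _ x H1 H2
  refine (congrArg Neg.neg key).trans ?_
  have hs : (0:ℝ) < 1 + ‖x‖ ^ 2 := by positivity
  have e1 : (1 + ‖x‖ ^ 2) ^ (-a - 1) = (1 + ‖x‖ ^ 2) ^ (-a) / (1 + ‖x‖ ^ 2) := Real.rpow_sub_one hs.ne' _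
  have e2 : (1 + ‖x‖ ^ 2) ^ (-a - 1 - 1) = (1 + ‖x‖ ^ 2) ^ (-a) / (1 + ‖x‖ ^ 2) / (1 + ‖x‖ ^ 2) := by
    rw [Real.rpow_sub_one hs.ne', e1]
  have e3 : (1 + ‖x‖ ^ 2) ^ (a + 1) = (1 + ‖x‖ ^ 2) ^ a * (1 + ‖x‖ ^ 2) := Real.rpow_add_one hs.ne' _
  have e4 : (1 + ‖x‖ ^ 2) ^ (a + 2) = (1 + ‖x‖ ^ 2) ^ a * (1 + ‖x‖ ^ 2) ^ 2 := by
    rw [Real.rpow_add hs]; norm_num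
  have hP : (1 + ‖x‖ ^ 2) ^ a ≠ 0 := (Real.rpow_pos_of_pos hs a).ne'
  simp [EuclideanSpace.inner_single_right, e1, e2, e3, e4]
  rw [Real.rpow_neg hs.le]
  generalize (1 + ‖x‖ ^ 2) ^ a = P at *
  field_simp
  ring

end
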